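/- If a bipartite graph G has matching with T rounds up to K (with load 1), then the 2-clone of G has matching up to K with T-expiration (with load 1). -/

import Mathlib

/-!
Bipartite graphs are modelled by a neighborhood function `Nbr : L → Finset R`
on finite types `L` (left nodes) and `R` (right nodes).

The dynamic matching game with parameters `K` and `ℓ` (the load):
Requester and Matcher maintain a set `M` of edges, initially empty, and alternate
turns with Requester first.  At round `n`, Requester removes a set of edges from `M`
(so that afterwards `#M ≤ K - 1`) and selects a left node; Matcher replies, according
to her strategy, by adding one edge of the graph incident on the selected node,
and afterwards every right node must be incident on at most `ℓ` edges of `M`.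
A strategy is winning if against every legal play of Requester all these
conditions always hold.
-/

namespace DM

/-- A Requester move: a set of edges to remove from the matching, and the requested left node. -/
abbrev ReqMove (α β : Type) := Finset (α × β) × α

/-- A Matcher strategy: maps each finite history of Requester moves to the set of
edges Matcher adds (a valid reply adds exactly one edge incident on the request). -/
abbrev Strategy (α β : Type) := List (ReqMove α β) → Finset (α × β)

/-- A Requester move in the ε-rich game: a set of left nodes whose requests are retracted
(all their matched edges are removed together), and the requested left node. -/
abbrev RReqMove (α : Type) := Finset α × α

/-- A Matcher strategy in the ε-rich game: maps each finite history of Requester moves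
to the set of edges Matcher adds. -/
abbrev RStrategy (α β : Type) := List (RReqMove α) → Finset (α × β)

variable {L R R₁ R₂ : Type} [DecidableEq L] [DecidableEq R] [DecidableEq R₁] [DecidableEq R₂]

/-- The set of neighbors of a set `S` of left nodes. -/
def NbrSet (Nbr : L → Finset R) (S : Finset L) : Finset R := S.biUnion Nbr

/-- The graph has `e`-expansion up to `K`: every left set `S` with `#S ≤ K`
has at least `e · #S` neighbors. -/
def Expansion (Nbr : L → Finset R) (e : ℚ) (K : ℕ) : Prop :=
  ∀ S : Finset L, S.card ≤ K → e * (S.card : ℚ) ≤ ((NbrSet Nbr S).card : ℚ)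

/-- The `ℓ`-clone of a graph: `ℓ` copies of the right set, with `x` adjacent to `(y, i)`
iff `x` is adjacent to `y` in the original graph. -/
def clone (ℓ : ℕ) (Nbr : L → Finset R) : L → Finset (R × Fin ℓ) :=
  fun x => (Nbr x) ×ˢ (Finset.univ : Finset (Fin ℓ))

/-- The product of two graphs with the same left set: `x` is adjacent to `(y₁, y₂)` iff
`x` is adjacent to `y₁` in the first graph and to `y₂` in the second graph. -/
def prodGraph (Nbr₁ : L → Finset R₁) (Nbr₂ : L → Finset R₂) : L → Finset (R₁ × R₂) :=
  fun x => (Nbr₁ x) ×ˢ (Nbr₂ x)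

/-- The private neighbors of a left set `S`: right nodes with exactly one neighbor in `S`. -/
def privNbrs [Fintype R] (Nbr : L → Finset R) (S : Finset L) : Finset R :=
  Finset.univ.filter fun y => (S.filter fun x => y ∈ Nbr x).card = 1

/-- The history of Requester moves after round `n` (i.e. the moves of rounds `0, …, n`). -/
def histUpTo (req : ℕ → ReqMove L R) (n : ℕ) : List (ReqMove L R) :=
  List.ofFn fun i : Fin (n + 1) => req i.1

/-- The matching `M` after round `n` of play: at round `n`, Requester removes the edges
`(req n).1` and requests `(req n).2`, then Matcher adds the edge(s) given by her strategy. -/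
def matchingAfter (σ : Strategy L R) (req : ℕ → ReqMove L R) : ℕ → Finset (L × R)
  | 0 => ∅
  | n + 1 => σ (histUpTo req n) ∪ (matchingAfter σ req n \ (req n).1)

/-- Requester's move at round `n` is legal: after his removal, `#M ≤ K - 1`. -/
def RemLegal (σ : Strategy L R) (K : ℕ) (req : ℕ → ReqMove L R) (n : ℕ) : Prop :=
  (matchingAfter σ req n \ (req n).1).card < K

/-- Matcher's reply at round `n` is valid for load `ℓ`: she adds exactly one edge of the
graph, incident on the requested node, and afterwards every right node is incident on
at most `ℓ` edges of `M`. -/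
def ValidReply (Nbr : L → Finset R) (ℓ : ℕ) (σ : Strategy L R)
    (req : ℕ → ReqMove L R) (n : ℕ) : Prop :=
  (∃ y ∈ Nbr (req n).2, σ (histUpTo req n) = {((req n).2, y)}) ∧
  ∀ y : R, ((matchingAfter σ req (n + 1)).filter fun p => p.2 = y).card ≤ ℓ

/-- The graph has dynamic matching up to `K` with load `ℓ`: Matcher has a strategy that
replies validly to every legal play of Requester. -/
def DynamicMatching (Nbr : L → Finset R) (K ℓ : ℕ) : Prop :=
  ∃ σ : Strategy L R, ∀ req : ℕ → ReqMove L R, ∀ n : ℕ,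
    (∀ i ≤ n, RemLegal σ K req i) → ValidReply Nbr ℓ σ req n

/-- Incremental matching up to `K` with load `ℓ`: Requester never removes edges,
and the game lasts at most `K` rounds. -/
def IncrementalMatching (Nbr : L → Finset R) (K ℓ : ℕ) : Prop :=
  ∃ σ : Strategy L R, ∀ req : ℕ → ReqMove L R, (∀ i, (req i).1 = ∅) →
    ∀ n < K, ValidReply Nbr ℓ σ req n

/-- Matching with `T` rounds up to `K` with load `ℓ`: the dynamic matching game is
terminated after `T` rounds. -/
def RoundMatching (Nbr : L → Finset R) (T K ℓ : ℕ) : Prop :=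
  ∃ σ : Strategy L R, ∀ req : ℕ → ReqMove L R, ∀ n < T,
    (∀ i ≤ n, RemLegal σ K req i) → ValidReply Nbr ℓ σ req n

/-- The edge Matcher added at round `i` is removed by Requester during one of the
rounds `i + 1, …, i + T`. -/
def ExpiredAt (σ : Strategy L R) (T : ℕ) (req : ℕ → ReqMove L R) (i : ℕ) : Prop :=
  ∃ j, i < j ∧ j ≤ i + T ∧ ∀ e ∈ σ (histUpTo req i), e ∈ (req j).1

/-- Matching up to `K` with `T`-expiration and load `ℓ`: the dynamic matching game in
which Requester must remove the edge added at round `i` during one of the rounds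
`i + 1, …, i + T`. -/
def ExpiringMatching (Nbr : L → Finset R) (T K ℓ : ℕ) : Prop :=
  ∃ σ : Strategy L R, ∀ req : ℕ → ReqMove L R, ∀ n : ℕ,
    (∀ i ≤ n, RemLegal σ K req i) → (∀ i, i + T ≤ n → ExpiredAt σ T req i) →
    ValidReply Nbr ℓ σ req n

/-! ### The ε-rich matching game

In the ε-rich game on a graph with left degree `D`, when Requester requests a left node
`x`, Matcher adds to `M` in one round a set of at least `(1 - ε) · D` edges incident on
`x`; when Requester retracts a request, all its edges are removed together. -/

/-- The history of rich-game Requester moves after round `n`. -/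
def rhistUpTo (req : ℕ → RReqMove L) (n : ℕ) : List (RReqMove L) :=
  List.ofFn fun i : Fin (n + 1) => req i.1

/-- The matching `M` after round `n` of the rich game: at round `n`, Requester retracts
the requests of the left nodes in `(req n).1` (removing all their edges) and requests
`(req n).2`, then Matcher adds the set of edges given by her strategy. -/
def rmatchingAfter (σ : RStrategy L R) (req : ℕ → RReqMove L) : ℕ → Finset (L × R)
  | 0 => ∅
  | n + 1 => σ (rhistUpTo req n) ∪
      ((rmatchingAfter σ req n).filter fun p => p.1 ∉ (req n).1)

/-- Requester's rich-game move at round `n` is legal: after the retraction, at most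
`K - 1` requests remain matched. -/
def RRemLegal (σ : RStrategy L R) (K : ℕ) (req : ℕ → RReqMove L) (n : ℕ) : Prop :=
  ((((rmatchingAfter σ req n).filter fun p => p.1 ∉ (req n).1)).image Prod.fst).card < K

/-- Matcher's rich reply at round `n` is valid for richness `ε` (relative to left degree
`D`) and load `ℓ`: she adds at least `(1 - ε) · D` edges of the graph, all incident on
the requested node, and afterwards every right node is incident on at most `ℓ` edges. -/
def RValidReply (Nbr : L → Finset R) (D : ℕ) (ε : ℚ) (ℓ : ℕ) (σ : RStrategy L R)
    (req : ℕ → RReqMove L) (n : ℕ) : Prop :=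
  (∀ e ∈ σ (rhistUpTo req n), e.1 = (req n).2 ∧ e.2 ∈ Nbr e.1) ∧
  (1 - ε) * (D : ℚ) ≤ ((σ (rhistUpTo req n)).card : ℚ) ∧
  ∀ y : R, ((rmatchingAfter σ req (n + 1)).filter fun p => p.2 = y).card ≤ ℓ

/-- ε-rich matching up to `K` with load `ℓ` (richness relative to left degree `D`). -/
def RichMatching (Nbr : L → Finset R) (D : ℕ) (ε : ℚ) (K ℓ : ℕ) : Prop :=
  ∃ σ : RStrategy L R, ∀ req : ℕ → RReqMove L, ∀ n : ℕ,
    (∀ i ≤ n, RRemLegal σ K req i) → RValidReply Nbr D ε ℓ σ req n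

/-- Incremental ε-rich matching up to `K` with load `ℓ`: Requester never retracts,
and the game lasts at most `K` rounds. -/
def RichIncrementalMatching (Nbr : L → Finset R) (D : ℕ) (ε : ℚ) (K ℓ : ℕ) : Prop :=
  ∃ σ : RStrategy L R, ∀ req : ℕ → RReqMove L, (∀ i, (req i).1 = ∅) →
    ∀ n < K, RValidReply Nbr D ε ℓ σ req n

/-- ε-rich matching up to `K` with `T`-expiration and load `ℓ`: Requester must retract
the request made at round `i` during one of the rounds `i + 1, …, i + T`. -/
def RichExpiringMatching (Nbr : L → Finset R) (D : ℕ) (ε : ℚ) (T K ℓ : ℕ) : Prop :=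
  ∃ σ : RStrategy L R, ∀ req : ℕ → RReqMove L, ∀ n : ℕ,
    (∀ i ≤ n, RRemLegal σ K req i) →
    (∀ i, i + T ≤ n → ∃ j, i < j ∧ j ≤ i + T ∧ (req i).2 ∈ (req j).1) →
    RValidReply Nbr D ε ℓ σ req n

end DM

namespace DM

variable {L R : Type} [DecidableEq L] [DecidableEq R]

/-- The copy of the graph inside its 2-clone that is used during block `k` of rounds. -/
def blockCopy (k : ℕ) : Fin 2 := ⟨k % 2, Nat.mod_lt _ (by norm_num)⟩

/-- The restriction of a Requester move on the 2-clone to copy `c`. -/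
def projMove (c : Fin 2) (m : ReqMove L (R × Fin 2)) : ReqMove L R :=
  ((m.1.filter fun p => p.2.2 = c).image fun p => (p.1, p.2.1), m.2)

/-- The strategy on the 2-clone which cuts time into blocks of `T` rounds and, in each block,
restarts `σ` on the copy alternating with that of the previous block. -/
def blockStrategy (T : ℕ) (σ : Strategy L R) : Strategy L (R × Fin 2) := fun hist =>
  let k := (hist.length - 1) / T
  (σ ((hist.drop (k * T)).map (projMove (blockCopy k)))).image
    fun p => (p.1, (p.2, blockCopy k))

/-- The play of Requester in block `k`, as seen by the strategy on the original graph. -/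
def blockPlay (T : ℕ) (req : ℕ → ReqMove L (R × Fin 2)) (k r : ℕ) : ReqMove L R :=
  projMove (blockCopy k) (req (k * T + r))

lemma blockStrategy_histUpTo (T : ℕ) (σ : Strategy L R) (req : ℕ → ReqMove L (R × Fin 2))
    {k r : ℕ} (hr : r < T) :
    blockStrategy T σ (histUpTo req (k * T + r)) =
      (σ (histUpTo (blockPlay T req k) r)).image fun p => (p.1, (p.2, blockCopy k)) := by
  have hk : (k * T + r) / T = k := by
    rw [Nat.add_comm, Nat.add_mul_div_right _ _ (by omega), Nat.div_eq_of_lt hr, zero_add]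
  have hist : ((histUpTo req (k * T + r)).drop (k * T)).map (projMove (blockCopy k)) =
      histUpTo (blockPlay T req k) r := by
    apply List.ext_getElem
    · simp [histUpTo]; omega
    · intro i h₁ h₂
      simp only [histUpTo, blockPlay, List.getElem_map, List.getElem_drop, List.getElem_ofFn]
  simp only [blockStrategy]
  have hlen : (histUpTo req (k * T + r)).length - 1 = k * T + r := by simp [histUpTo]
  rw [hlen, hk, hist]

lemma exists_added_of_mem_matchingAfter {σ : Strategy L R} {req : ℕ → ReqMove L R} {n : ℕ}
    {e : L × R} (he : e ∈ matchingAfter σ req n) :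
    ∃ i < n, e ∈ σ (histUpTo req i) ∧ ∀ j, i < j → j < n → e ∉ (req j).1 := by
  induction n with
  | zero => simp [matchingAfter] at he
  | succ n ih =>
    rw [matchingAfter, Finset.mem_union, Finset.mem_sdiff] at he
    rcases he with he | ⟨he, hne⟩
    · exact ⟨n, n.lt_succ_self, he, fun j h₁ h₂ => by omega⟩
    · obtain ⟨i, hi, hadd, hrem⟩ := ih he
      refine ⟨i, by omega, hadd, fun j h₁ h₂ => ?_⟩
      rcases Nat.lt_succ_iff_lt_or_eq.mp h₂ with h | rfl
      · exact hrem j h₁ h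
      · exact hne

/-- At the start of block `k` all edges in the copy used in block `k` have expired. -/
lemma notMem_matchingAfter_block_start {T : ℕ} (hT : 0 < T) {σ : Strategy L R}
    {req : ℕ → ReqMove L (R × Fin 2)} {k : ℕ}
    (hexp : ∀ i, i + T < k * T → ExpiredAt (blockStrategy T σ) T req i) (x : L) (y : R) :
    (x, (y, blockCopy k)) ∉ matchingAfter (blockStrategy T σ) req (k * T) := by
  intro he
  obtain ⟨i, hi, hadd, hrem⟩ := exists_added_of_mem_matchingAfter he
  have hmem := hadd
  rw [← Nat.div_add_mod' i T, blockStrategy_histUpTo T σ req (Nat.mod_lt i hT)] at hmem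
  have hcopy : blockCopy (i / T) = blockCopy k := by
    simp only [Finset.mem_image, Prod.mk.injEq] at hmem
    obtain ⟨p, -, -, -, h⟩ := hmem
    exact h
  have hlt : i / T < k := (Nat.div_lt_iff_lt_mul hT).mpr hi
  have hne : i / T + 1 < k := by
    simp only [blockCopy, Fin.mk.injEq] at hcopy
    omega
  have hiT : i + T < k * T := by
    rw [← Nat.div_lt_iff_lt_mul hT, Nat.add_div_right _ hT]
    exact hne
  obtain ⟨j, hij, hj, hall⟩ := hexp i hiT
  exact hrem j hij (by omega) (hall _ hadd)

lemma mem_projMove (c : Fin 2) (m : ReqMove L (R × Fin 2)) (x : L) (y : R) :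
    (x, y) ∈ (projMove c m).1 ↔ (x, (y, c)) ∈ m.1 := by
  simp only [projMove, Finset.mem_image, Finset.mem_filter, Prod.mk.injEq]
  constructor
  · rintro ⟨⟨x', y', c'⟩, ⟨h, rfl⟩, rfl, rfl⟩
    exact h
  · exact fun h => ⟨_, ⟨h, rfl⟩, rfl, rfl⟩

/-- Within block `k`, the current copy carries exactly the matching of the simulated game. -/
lemma mem_matchingAfter_block {T : ℕ} (hT : 0 < T) {σ : Strategy L R}
    {req : ℕ → ReqMove L (R × Fin 2)} {k : ℕ}
    (hexp : ∀ i, i + T < k * T → ExpiredAt (blockStrategy T σ) T req i)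
    {r : ℕ} (hr : r ≤ T) (x : L) (y : R) :
    (x, (y, blockCopy k)) ∈ matchingAfter (blockStrategy T σ) req (k * T + r) ↔
      (x, y) ∈ matchingAfter σ (blockPlay T req k) r := by
  induction r with
  | zero =>
    simpa [matchingAfter] using notMem_matchingAfter_block_start hT hexp x y
  | succ r ih =>
    rw [← Nat.add_assoc, matchingAfter, matchingAfter, blockStrategy_histUpTo T σ req hr,
      Finset.mem_union, Finset.mem_union, Finset.mem_sdiff, Finset.mem_sdiff,
      ih (by omega), blockPlay, mem_projMove]
    simp

lemma card_filter_eq_of_mem_iff {α β γ : Type*} [DecidableEq β] [DecidableEq γ]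
    {M : Finset (α × (β × γ))} {N : Finset (α × β)} {c : γ}
    (h : ∀ x y, (x, (y, c)) ∈ M ↔ (x, y) ∈ N) (y : β) :
    (M.filter fun p => p.2 = (y, c)).card = (N.filter fun p => p.2 = y).card := by
  symm
  refine Finset.card_bij (fun p _ => (p.1, (p.2, c))) ?_ ?_ ?_
  · rintro ⟨x, y'⟩ hp
    simpa [h] using hp
  · rintro ⟨x, y'⟩ _ ⟨x', y''⟩ _ heq
    simpa using heq
  · rintro ⟨x, y', c'⟩ hp
    simp only [Finset.mem_filter, Prod.mk.injEq] at hp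
    obtain ⟨hM, rfl, rfl⟩ := hp
    exact ⟨(x, y'), by simpa [← h] using hM, rfl⟩

lemma remLegal_blockPlay {T K : ℕ} (hT : 0 < T) {σ : Strategy L R}
    {req : ℕ → ReqMove L (R × Fin 2)} {k : ℕ}
    (hexp : ∀ i, i + T < k * T → ExpiredAt (blockStrategy T σ) T req i)
    {r : ℕ} (hr : r ≤ T) (hleg : RemLegal (blockStrategy T σ) K req (k * T + r)) :
    RemLegal σ K (blockPlay T req k) r := by
  refine lt_of_le_of_lt ?_ hleg
  refine Finset.card_le_card_of_injOn (fun p => (p.1, (p.2, blockCopy k))) ?_ ?_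
  · rintro ⟨x, y⟩ hp
    simp only [Finset.coe_sdiff, Set.mem_sdiff, Finset.mem_coe] at hp ⊢
    rwa [blockPlay, mem_projMove, ← mem_matchingAfter_block hT hexp hr] at hp
  · rintro ⟨x, y⟩ _ ⟨x', y'⟩ _ heq
    simpa using heq

end DM

open DM
/-- If a bipartite graph has matching with `T` rounds up to `K` with load 1,
then its 2-clone has matching up to `K` with `T`-expiration, with load 1. -/
theorem stmt6 (L R : Type) [Fintype L] [Fintype R] [DecidableEq L] [DecidableEq R]
    (Nbr : L → Finset R) (T K : ℕ)
    (h : RoundMatching Nbr T K 1) :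
    ExpiringMatching (clone 2 Nbr) T K 1 := by
  obtain ⟨σ, hσ⟩ := h
  refine ⟨blockStrategy T σ, fun req n => ?_⟩
  rcases Nat.eq_zero_or_pos T with rfl | hT
  · intro _ hexp
    obtain ⟨j, h₁, h₂, -⟩ := hexp 0 (by omega)
    omega
  induction n using Nat.strong_induction_on with
  | _ n ih =>
  intro hleg hexp
  obtain ⟨k, r, hr, rfl⟩ : ∃ k r, r < T ∧ n = k * T + r :=
    ⟨n / T, n % T, Nat.mod_lt n hT, (Nat.div_add_mod' n T).symm⟩
  have hexp' : ∀ i, i + T < k * T → ExpiredAt (blockStrategy T σ) T req i :=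
    fun i hi => hexp i (by omega)
  obtain ⟨⟨y, hy, hσy⟩, hload⟩ := hσ (blockPlay T req k) r hr fun i hi =>
    remLegal_blockPlay hT hexp' (by omega) (hleg _ (by omega))
  have hreply : blockStrategy T σ (histUpTo req (k * T + r)) =
      {((req (k * T + r)).2, (y, blockCopy k))} := by
    rw [blockStrategy_histUpTo T σ req hr, hσy, Finset.image_singleton]
    rfl
  refine ⟨⟨(y, blockCopy k), ?_, hreply⟩, ?_⟩
  · exact Finset.mem_product.mpr ⟨hy, Finset.mem_univ _⟩
  rintro ⟨z, c⟩
  by_cases hc : c = blockCopy k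
  · subst hc
    rw [Nat.add_assoc, card_filter_eq_of_mem_iff fun x y =>
      mem_matchingAfter_block hT hexp' (r := r + 1) hr x y]
    exact hload z
  · have hprev : ((matchingAfter (blockStrategy T σ) req (k * T + r)).filter
        fun p => p.2 = (z, c)).card ≤ 1 := by
      rcases hn : k * T + r with _ | m
      · simp [matchingAfter]
      · exact (ih m (by omega) (fun i hi => hleg i (by omega))
          fun i hi => hexp i (by omega)).2 (z, c)
    refine (Finset.card_le_card fun p hp => ?_).trans hprev
    rw [matchingAfter, hreply, Finset.mem_filter, Finset.mem_union, Finset.mem_singleton,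
      Finset.mem_sdiff] at hp
    obtain ⟨rfl | ⟨hp, -⟩, hpz⟩ := hp
    · exact absurd (congrArg Prod.snd hpz).symm hc
    · exact Finset.mem_filter.mpr ⟨hp, hpz⟩
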